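/- Suppose every α_i > 0 and ς̄ ∈ ℝ^m is a critical point of P^d with G(ς̄) positive definite. Then strong duality holds with attainment: min_{x ∈ ℝⁿ} P(x) = Ξ(x̄, ς̄) = max_{ς ∈ S_a⁺} P^d(ς), where x̄ = G(ς̄)⁻¹ F(ς̄) and S_a⁺ = {ς ∈ ℝ^m : G(ς) is positive definite}. -/

import Mathlib

open Matrix

/-- The primal function `P(x) = Σᵢ (αᵢ/2)(½xᵀAᵢx + bᵢᵀx + cᵢ)² + ½xᵀQx − xᵀf`. -/
noncomputable def primalP {n m : ℕ} (Q : Matrix (Fin n) (Fin n) ℝ)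
    (A : Fin m → Matrix (Fin n) (Fin n) ℝ) (f : Fin n → ℝ) (b : Fin m → Fin n → ℝ)
    (c α : Fin m → ℝ) (x : Fin n → ℝ) : ℝ :=
  (∑ i, α i / 2 * ((1 / 2) * (x ⬝ᵥ (A i).mulVec x) + b i ⬝ᵥ x + c i) ^ 2)
    + (1 / 2) * (x ⬝ᵥ Q.mulVec x) - x ⬝ᵥ f

/-- `F(ς) = f − Σᵢ ςᵢ bᵢ`. -/
noncomputable def Fvec {n m : ℕ} (f : Fin n → ℝ) (b : Fin m → Fin n → ℝ)
    (ς : Fin m → ℝ) : Fin n → ℝ :=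
  f - ∑ i, ς i • b i

/-- `G(ς) = Q + Σᵢ ςᵢ Aᵢ`. -/
noncomputable def Gmat {n m : ℕ} (Q : Matrix (Fin n) (Fin n) ℝ)
    (A : Fin m → Matrix (Fin n) (Fin n) ℝ) (ς : Fin m → ℝ) : Matrix (Fin n) (Fin n) ℝ :=
  Q + ∑ i, ς i • A i

/-- The canonical dual function
`P^d(ς) = Σᵢ (cᵢςᵢ − ςᵢ²/(2αᵢ)) − ½ F(ς)ᵀ G(ς)⁻¹ F(ς)`. -/
noncomputable def dualP {n m : ℕ} (Q : Matrix (Fin n) (Fin n) ℝ)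
    (A : Fin m → Matrix (Fin n) (Fin n) ℝ) (f : Fin n → ℝ) (b : Fin m → Fin n → ℝ)
    (c α : Fin m → ℝ) (ς : Fin m → ℝ) : ℝ :=
  (∑ i, (c i * ς i - ς i ^ 2 / (2 * α i)))
    - (1 / 2) * (Fvec f b ς ⬝ᵥ (Gmat Q A ς)⁻¹.mulVec (Fvec f b ς))

/-- The Gao–Strang complementary function
`Ξ(x,ς) = Σᵢ [(½xᵀAᵢx + bᵢᵀx + cᵢ)ςᵢ − ςᵢ²/(2αᵢ)] + ½xᵀQx − xᵀf`. -/
noncomputable def GaoStrangXi {n m : ℕ} (Q : Matrix (Fin n) (Fin n) ℝ)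
    (A : Fin m → Matrix (Fin n) (Fin n) ℝ) (f : Fin n → ℝ) (b : Fin m → Fin n → ℝ)
    (c α : Fin m → ℝ) (x : Fin n → ℝ) (ς : Fin m → ℝ) : ℝ :=
  (∑ i, (((1 / 2) * (x ⬝ᵥ (A i).mulVec x) + b i ⬝ᵥ x + c i) * ς i - ς i ^ 2 / (2 * α i)))
    + (1 / 2) * (x ⬝ᵥ Q.mulVec x) - x ⬝ᵥ f

theorem sd_inv_entry {n m : ℕ} (Q : Matrix (Fin n) (Fin n) ℝ)
    (A : Fin m → Matrix (Fin n) (Fin n) ℝ) (s : Fin m → ℝ)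
    (h : IsUnit (Gmat Q A s).det) (j k : Fin n) :
    DifferentiableAt ℝ (fun ς => (Gmat Q A ς)⁻¹ j k) s := by
  let : NormedRing (Matrix (Fin n) (Fin n) ℝ) := Matrix.linftyOpNormedRing
  let : NormedAlgebra ℝ (Matrix (Fin n) (Fin n) ℝ) := Matrix.linftyOpNormedAlgebra
  have : FiniteDimensional ℝ (Matrix (Fin n) (Fin n) ℝ) := by infer_instance
  have : CompleteSpace (Matrix (Fin n) (Fin n) ℝ) := FiniteDimensional.complete ℝ _
  have hG : DifferentiableAt ℝ (fun ς : Fin m → ℝ => Gmat Q A ς) s := by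
    unfold Gmat
    fun_prop
  have hu : IsUnit (Gmat Q A s) := (Matrix.isUnit_iff_isUnit_det _).2 h
  have h1 : DifferentiableAt ℝ (fun ς : Fin m → ℝ => Ring.inverse (Gmat Q A ς)) s :=
    DifferentiableAt.comp s (differentiableAt_inverse hu) hG
  let L : Matrix (Fin n) (Fin n) ℝ →ₗ[ℝ] ℝ :=
    { toFun := fun M => M j k, map_add' := fun _ _ => rfl, map_smul' := fun _ _ => rfl }
  have h2 := (LinearMap.toContinuousLinearMap L).differentiableAt.comp s h1
  have e : (fun ς => (Gmat Q A ς)⁻¹ j k) =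
      (LinearMap.toContinuousLinearMap L) ∘ (fun ς : Fin m → ℝ => Ring.inverse (Gmat Q A ς)) := by
    funext ς
    rw [Matrix.nonsing_inv_eq_ringInverse]
    rfl
  rw [e]
  exact h2

theorem sd_Gmat_isSymm {n m : ℕ} {Q : Matrix (Fin n) (Fin n) ℝ}
    {A : Fin m → Matrix (Fin n) (Fin n) ℝ} (hQ : Q.IsSymm) (hA : ∀ i, (A i).IsSymm)
    (ς : Fin m → ℝ) : (Gmat Q A ς).IsSymm := by
  unfold Gmat Matrix.IsSymm
  rw [Matrix.transpose_add, hQ.eq, Matrix.transpose_sum]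
  simp [(hA _).eq]

theorem sd_xi_eq {n m : ℕ} (Q : Matrix (Fin n) (Fin n) ℝ)
    (A : Fin m → Matrix (Fin n) (Fin n) ℝ) (f : Fin n → ℝ) (b : Fin m → Fin n → ℝ)
    (c α : Fin m → ℝ) (x : Fin n → ℝ) (ς : Fin m → ℝ) :
    GaoStrangXi Q A f b c α x ς = (∑ i, (c i * ς i - ς i ^ 2 / (2 * α i)))
      + (1 / 2) * (x ⬝ᵥ (Gmat Q A ς).mulVec x) - x ⬝ᵥ Fvec f b ς := by
  have h1 : x ⬝ᵥ (Gmat Q A ς).mulVec x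
      = x ⬝ᵥ Q.mulVec x + ∑ i, ς i * (x ⬝ᵥ (A i).mulVec x) := by
    unfold Gmat
    rw [Matrix.add_mulVec, Matrix.sum_mulVec, dotProduct_add, dotProduct_sum]
    simp [Matrix.smul_mulVec, dotProduct_smul]
  have h2 : x ⬝ᵥ Fvec f b ς = x ⬝ᵥ f - ∑ i, ς i * (b i ⬝ᵥ x) := by
    unfold Fvec
    rw [dotProduct_sub, dotProduct_sum]
    simp [dotProduct_smul, dotProduct_comm x]
  rw [h1, h2]
  unfold GaoStrangXi
  have h3 : (∑ i, (((1 / 2) * (x ⬝ᵥ (A i).mulVec x) + b i ⬝ᵥ x + c i) * ς i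
      - ς i ^ 2 / (2 * α i))) = (∑ i, (c i * ς i - ς i ^ 2 / (2 * α i)))
      + (1 / 2) * (∑ i, ς i * (x ⬝ᵥ (A i).mulVec x)) + ∑ i, ς i * (b i ⬝ᵥ x) := by
    rw [Finset.mul_sum, ← Finset.sum_add_distrib, ← Finset.sum_add_distrib]
    exact Finset.sum_congr rfl fun i _ => by ring
  rw [h3]
  ring

theorem sd_dual_eq {n m : ℕ} {Q : Matrix (Fin n) (Fin n) ℝ}
    {A : Fin m → Matrix (Fin n) (Fin n) ℝ} (f : Fin n → ℝ) (b : Fin m → Fin n → ℝ)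
    (c α : Fin m → ℝ) (hQ : Q.IsSymm) (hA : ∀ i, (A i).IsSymm)
    (x : Fin n → ℝ) (ς : Fin m → ℝ) (h : IsUnit (Gmat Q A ς).det) :
    dualP Q A f b c α ς = GaoStrangXi Q A f b c α x ς
      - (1 / 2) * (((Gmat Q A ς).mulVec x - Fvec f b ς) ⬝ᵥ
        (Gmat Q A ς)⁻¹.mulVec ((Gmat Q A ς).mulVec x - Fvec f b ς)) := by
  rw [sd_xi_eq]
  unfold dualP
  have hs := sd_Gmat_isSymm hQ hA ς
  generalize Gmat Q A ς = G at *
  generalize Fvec f b ς = F at *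
  have e1 : G⁻¹.mulVec (G.mulVec x) = x := by
    rw [Matrix.mulVec_mulVec, Matrix.nonsing_inv_mul _ h, Matrix.one_mulVec]
  have e2 : (G.mulVec x) ⬝ᵥ G⁻¹.mulVec F = x ⬝ᵥ F := by
    have : G.mulVec x = Matrix.vecMul x G := by
      rw [← Matrix.mulVec_transpose, hs.eq]
    rw [this, ← Matrix.dotProduct_mulVec, Matrix.mulVec_mulVec, Matrix.mul_nonsing_inv _ h,
      Matrix.one_mulVec]
  rw [Matrix.mulVec_sub, e1, sub_dotProduct, dotProduct_sub, dotProduct_sub, e2,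
    dotProduct_comm F x, dotProduct_comm (G.mulVec x) x]
  ring

theorem sd_primal_sub {n m : ℕ} (Q : Matrix (Fin n) (Fin n) ℝ)
    (A : Fin m → Matrix (Fin n) (Fin n) ℝ) (f : Fin n → ℝ) (b : Fin m → Fin n → ℝ)
    (c α : Fin m → ℝ) (hα : ∀ i, 0 < α i) (x : Fin n → ℝ) (ς : Fin m → ℝ) :
    primalP Q A f b c α x = GaoStrangXi Q A f b c α x ς
      + ∑ i, α i / 2 * ((1 / 2) * (x ⬝ᵥ (A i).mulVec x) + b i ⬝ᵥ x + c i - ς i / α i) ^ 2 := by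
  have h : (∑ i, α i / 2 * ((1 / 2) * (x ⬝ᵥ (A i).mulVec x) + b i ⬝ᵥ x + c i) ^ 2)
      = (∑ i, (((1 / 2) * (x ⬝ᵥ (A i).mulVec x) + b i ⬝ᵥ x + c i) * ς i - ς i ^ 2 / (2 * α i)))
      + ∑ i, α i / 2 * ((1 / 2) * (x ⬝ᵥ (A i).mulVec x) + b i ⬝ᵥ x + c i - ς i / α i) ^ 2 := by
    rw [← Finset.sum_add_distrib]
    refine Finset.sum_congr rfl fun i _ => ?_
    have := (hα i).ne'
    generalize (1 / 2) * (x ⬝ᵥ (A i).mulVec x) + b i ⬝ᵥ x + c i = y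
    field_simp
    ring
  unfold primalP GaoStrangXi
  rw [h]
  ring

theorem sd_quad_diff {E : Type*} [NormedAddCommGroup E] [NormedSpace ℝ E] {n : ℕ}
    (M : E → Matrix (Fin n) (Fin n) ℝ) (u : E → Fin n → ℝ) (s : E)
    (hM : ∀ j k, DifferentiableAt ℝ (fun t => M t j k) s)
    (hu : ∀ j, DifferentiableAt ℝ (fun t => u t j) s) :
    DifferentiableAt ℝ (fun t => u t ⬝ᵥ (M t).mulVec (u t)) s := by
  simp only [dotProduct, Matrix.mulVec]
  exact DifferentiableAt.fun_sum fun j _ => (hu j).fun_mul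
    (DifferentiableAt.fun_sum fun k _ => (hM j k).fun_mul (hu k))

theorem sd_dual_diff {n m : ℕ} (Q : Matrix (Fin n) (Fin n) ℝ)
    (A : Fin m → Matrix (Fin n) (Fin n) ℝ) (f : Fin n → ℝ) (b : Fin m → Fin n → ℝ)
    (c α : Fin m → ℝ) (s : Fin m → ℝ) (h : IsUnit (Gmat Q A s).det) :
    DifferentiableAt ℝ (dualP Q A f b c α) s := by
  have hi := sd_inv_entry Q A s h
  have hF : ∀ j, DifferentiableAt ℝ (fun t => Fvec f b t j) s := by
    intro j
    simp only [Fvec, Pi.sub_apply, Finset.sum_apply, Pi.smul_apply, smul_eq_mul]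
    fun_prop
  have hq := sd_quad_diff (fun t => (Gmat Q A t)⁻¹) (fun t => Fvec f b t) s hi hF
  have h1 : DifferentiableAt ℝ
      (fun t : Fin m → ℝ => ∑ i, (c i * t i - t i ^ 2 / (2 * α i))) s := by
    simp only [div_eq_mul_inv]
    fun_prop
  exact h1.fun_sub (hq.const_mul (1 / 2))

theorem sd_crit {n m : ℕ} {Q : Matrix (Fin n) (Fin n) ℝ}
    {A : Fin m → Matrix (Fin n) (Fin n) ℝ} (f : Fin n → ℝ) (b : Fin m → Fin n → ℝ)
    (c α : Fin m → ℝ) (hQ : Q.IsSymm) (hA : ∀ i, (A i).IsSymm) (s : Fin m → ℝ)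
    (hcrit : fderiv ℝ (dualP Q A f b c α) s = 0) (h : IsUnit (Gmat Q A s).det)
    (x : Fin n → ℝ) (hx : (Gmat Q A s).mulVec x = Fvec f b s) (i : Fin m) :
    (1 / 2) * (x ⬝ᵥ (A i).mulVec x) + b i ⬝ᵥ x + c i - s i / α i = 0 := by
  let l : ℝ → Fin m → ℝ := fun t => s + t • Pi.single i 1
  have hl0 : l 0 = s := by simp [l]
  have hl : HasDerivAt l (Pi.single i 1) 0 := by
    have := ((hasDerivAt_id (0 : ℝ)).smul_const (Pi.single i (1 : ℝ) : Fin m → ℝ)).const_add s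
    simpa [l] using this
  have hd : HasDerivAt (fun t => dualP Q A f b c α (l t)) 0 0 := by
    have h1 := (sd_dual_diff Q A f b c α s h).hasFDerivAt
    rw [hcrit, ← hl0] at h1
    exact h1.comp_hasDerivAt (0 : ℝ) hl
  let v : Fin n → ℝ := (A i).mulVec x + b i
  have hr : ∀ t, (Gmat Q A (l t)).mulVec x - Fvec f b (l t) = t • v := by
    intro t
    have e1 : Gmat Q A (l t) = Gmat Q A s + t • A i := by
      simp [Gmat, l, add_smul, Finset.sum_add_distrib, Pi.single_apply, add_assoc]
    have e2 : Fvec f b (l t) = Fvec f b s - t • b i := by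
      simp [Fvec, l, add_smul, Finset.sum_add_distrib, Pi.single_apply, sub_sub]
    rw [e1, e2, Matrix.add_mulVec, hx, Matrix.smul_mulVec]
    simp only [v, smul_add]
    abel
  have hev : ∀ᶠ t in nhds (0 : ℝ), IsUnit (Gmat Q A (l t)).det := by
    have hc : Continuous fun t => (Gmat Q A (l t)).det := by
      apply Continuous.matrix_det
      simp only [Gmat, l]
      fun_prop
    have := hc.continuousAt.eventually_ne (x := (0 : ℝ)) (y := 0) (by rw [hl0]; exact h.ne_zero)
    exact this.mono fun t ht => isUnit_iff_ne_zero.2 ht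
  have hq : DifferentiableAt ℝ (fun t => v ⬝ᵥ (Gmat Q A (l t))⁻¹.mulVec v) 0 := by
    have hi : ∀ j k, DifferentiableAt ℝ (fun t => (Gmat Q A (l t))⁻¹ j k) 0 := by
      intro j k
      have h1 := sd_inv_entry Q A s h j k
      rw [← hl0] at h1
      exact DifferentiableAt.comp (0 : ℝ) h1 hl.differentiableAt
    exact sd_quad_diff (fun t => (Gmat Q A (l t))⁻¹) (fun _ => v) 0 hi
      fun j => differentiableAt_const _
  have hX : HasDerivAt (fun t => GaoStrangXi Q A f b c α x (l t))
      ((1 / 2) * (x ⬝ᵥ (A i).mulVec x) + b i ⬝ᵥ x + c i - s i / α i) 0 := by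
    have hlj : ∀ j, HasDerivAt (fun t => l t j) ((Pi.single i 1 : Fin m → ℝ) j) 0 :=
      hasDerivAt_pi.1 hl
    have h1 := HasDerivAt.fun_sum (u := Finset.univ) fun j _ =>
      ((hlj j).const_mul ((1 / 2) * (x ⬝ᵥ (A j).mulVec x) + b j ⬝ᵥ x + c j)).sub
        (((hlj j).pow 2).div_const (2 * α j))
    have h2 := (h1.add_const ((1 / 2) * (x ⬝ᵥ Q.mulVec x))).sub_const (x ⬝ᵥ f)
    unfold GaoStrangXi
    refine h2.congr_deriv ?_
    rw [Finset.sum_eq_single i]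
    · simp only [hl0, Pi.single_eq_same]
      rw [show ((2 : ℕ) : ℝ) * s i ^ (2 - 1) * 1 / (2 * α i) = s i / α i by
        norm_num
        rw [mul_div_mul_left _ _ two_ne_zero]]
      ring
    · intro j _ hj
      simp [Pi.single_eq_of_ne hj]
    · simp
  have hR := hX.sub ((((hasDerivAt_id (0 : ℝ)).pow 2).mul hq.hasDerivAt).const_mul (1 / 2))
  have hR' := hR.congr_of_eventuallyEq (f₁ := fun t => dualP Q A f b c α (l t)) (by
    filter_upwards [hev] with t ht
    rw [sd_dual_eq f b c α hQ hA x (l t) ht, hr]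
    simp [Matrix.mulVec_smul, dotProduct_smul, smul_dotProduct]
    ring)
  have := hR'.unique hd
  simpa using this

/-- Strong duality with attainment: if every `αᵢ > 0` and `ς̄` is a critical point of `P^d`
with `G(ς̄)` positive definite, then `min_x P(x) = Ξ(x̄, ς̄) = max_{ς ∈ S_a⁺} P^d(ς)`,
where `x̄ = G(ς̄)⁻¹ F(ς̄)`, the minimum being attained at `x̄` and the maximum at `ς̄`. -/
theorem strong_duality {n m : ℕ} (Q : Matrix (Fin n) (Fin n) ℝ)
    (A : Fin m → Matrix (Fin n) (Fin n) ℝ) (f : Fin n → ℝ) (b : Fin m → Fin n → ℝ)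
    (c α : Fin m → ℝ) (hQ : Q.IsSymm) (hA : ∀ i, (A i).IsSymm)
    (hα : ∀ i, 0 < α i) (ςb : Fin m → ℝ)
    (hcrit : fderiv ℝ (dualP Q A f b c α) ςb = 0)
    (hG : (Gmat Q A ςb).PosDef)
    (xb : Fin n → ℝ) (hxb : xb = (Gmat Q A ςb)⁻¹.mulVec (Fvec f b ςb)) :
    (∀ x : Fin n → ℝ, primalP Q A f b c α xb ≤ primalP Q A f b c α x) ∧
      primalP Q A f b c α xb = GaoStrangXi Q A f b c α xb ςb ∧
      GaoStrangXi Q A f b c α xb ςb = dualP Q A f b c α ςb ∧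
      (∀ ς : Fin m → ℝ, (Gmat Q A ς).PosDef →
        dualP Q A f b c α ς ≤ dualP Q A f b c α ςb) := by
  have hu : ∀ ς, (Gmat Q A ς).PosDef → IsUnit (Gmat Q A ς).det :=
    fun ς h => isUnit_iff_ne_zero.2 h.det_pos.ne'
  have hx : (Gmat Q A ςb).mulVec xb = Fvec f b ςb := by
    rw [hxb, Matrix.mulVec_mulVec, Matrix.mul_nonsing_inv _ (hu _ hG), Matrix.one_mulVec]
  have hc := sd_crit f b c α hQ hA ςb hcrit (hu _ hG) xb hx
  have hP : primalP Q A f b c α xb = GaoStrangXi Q A f b c α xb ςb := by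
    rw [sd_primal_sub Q A f b c α hα xb ςb]
    simp only [hc]
    simp
  have hD : GaoStrangXi Q A f b c α xb ςb = dualP Q A f b c α ςb := by
    rw [sd_dual_eq f b c α hQ hA xb ςb (hu _ hG), hx]
    simp
  have hPX : ∀ x ς, GaoStrangXi Q A f b c α x ς ≤ primalP Q A f b c α x := by
    intro x ς
    rw [sd_primal_sub Q A f b c α hα x ς]
    have : 0 ≤ ∑ i, α i / 2 *
        ((1 / 2) * (x ⬝ᵥ (A i).mulVec x) + b i ⬝ᵥ x + c i - ς i / α i) ^ 2 :=
      Finset.sum_nonneg fun i _ => mul_nonneg (half_pos (hα i)).le (sq_nonneg _)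
    linarith
  have hDX : ∀ x ς, (Gmat Q A ς).PosDef →
      dualP Q A f b c α ς ≤ GaoStrangXi Q A f b c α x ς := by
    intro x ς h
    rw [sd_dual_eq f b c α hQ hA x ς (hu _ h)]
    have := h.inv.posSemidef.dotProduct_mulVec_nonneg ((Gmat Q A ς).mulVec x - Fvec f b ς)
    simp only [star_trivial] at this
    linarith
  refine ⟨fun x => ?_, hP, hD, fun ς h => ?_⟩
  · rw [hP, hD]
    exact (hDX x ςb hG).trans (hPX x ςb)
  · rw [← hD, ← hP]
    exact (hDX xb ς h).trans (hPX xb ς)
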